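/- There is a universal constant C (one may take C = 3) such that for every perfect graph G on n ≥ 1 vertices and every greedy stable-set sequence of G with associated greedy point of entropy g̃, one has g̃ ≤ H(G) + log₂(H(G) + 1) + C. -/

import Mathlib

/-- A stable (independent) set of a simple graph, as a `Finset` of vertices. -/
def IsStableSet {V : Type*} (G : SimpleGraph V) (S : Finset V) : Prop :=
  ∀ v ∈ S, ∀ w ∈ S, ¬ G.Adj v w

/-- The stable set polytope `STAB(G)`: the convex hull of characteristic vectors
of stable sets of `G`. -/
noncomputable def STAB {V : Type*} [Fintype V] [DecidableEq V] (G : SimpleGraph V) :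
    Set (V → ℝ) :=
  convexHull ℝ {x | ∃ S : Finset V, IsStableSet G S ∧
    x = fun v => if v ∈ S then (1 : ℝ) else 0}

/-- The (Körner) entropy of a graph `G` on `n` vertices:
`H(G) = min_{x ∈ STAB(G), x > 0} -(1/n) ∑_v log₂ x_v`. -/
noncomputable def graphEntropy {V : Type*} [Fintype V] [DecidableEq V]
    (G : SimpleGraph V) : ℝ :=
  sInf {h : ℝ | ∃ x ∈ STAB G, (∀ v, 0 < x v) ∧
    h = -(1 / (Fintype.card V : ℝ)) * ∑ v, Real.logb 2 (x v)}

/-- A graph is perfect if every induced subgraph has clique number equal to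
chromatic number. -/
def IsPerfect {V : Type*} (G : SimpleGraph V) : Prop :=
  ∀ U : Set V, ((G.induce U).cliqueNum : ℕ∞) = (G.induce U).chromaticNumber

/-- `S 0, S 1, …, S (k-1)` is a greedy stable-set sequence of `G`: the `S i` are
pairwise disjoint stable sets partitioning the vertex set, and each `S i` is a
maximum-cardinality stable set among those avoiding `S 0 ∪ ⋯ ∪ S (i-1)`. -/
def IsGreedySeq {V : Type*} [Fintype V] (G : SimpleGraph V) {k : ℕ}
    (S : Fin k → Finset V) : Prop :=
  (∀ i, IsStableSet G (S i)) ∧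
  (∀ i j, i ≠ j → Disjoint (S i) (S j)) ∧
  (∀ v : V, ∃ i, v ∈ S i) ∧
  (∀ i : Fin k, ∀ T : Finset V, IsStableSet G T →
    (∀ v ∈ T, ∀ j, j < i → v ∉ S j) → T.card ≤ (S i).card)

/-- The entropy `g̃ = ∑_i (|S i|/n) log₂ (n/|S i|)` of the greedy point
`x̃ = ∑_i (|S i|/n) χ^{S i}` associated to a greedy stable-set sequence. -/
noncomputable def greedyEntropy {V : Type*} [Fintype V] {k : ℕ}
    (S : Fin k → Finset V) : ℝ :=
  ∑ i, ((S i).card / (Fintype.card V : ℝ)) *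
    Real.logb 2 ((Fintype.card V : ℝ) / (S i).card)

theorem IsStableSet.mono {V : Type*} {G : SimpleGraph V} {S T : Finset V}
    (hT : IsStableSet G T) (h : S ⊆ T) : IsStableSet G S :=
  fun v hv w hw => hT v (h hv) w (h hw)

/-- A linear inequality valid for all stable sets is valid on `STAB G`. -/
theorem sum_mul_le_of_mem_STAB {V : Type*} [Fintype V] [DecidableEq V] {G : SimpleGraph V}
    {z : V → ℝ} {b : ℝ} (hz : ∀ T : Finset V, IsStableSet G T → ∑ v ∈ T, z v ≤ b)
    {x : V → ℝ} (hx : x ∈ STAB G) : ∑ v, z v * x v ≤ b := by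
  have hconv : Convex ℝ {y : V → ℝ | ∑ v, z v * y v ≤ b} := by
    refine convex_halfSpace_le ⟨fun y w => ?_, fun c y => ?_⟩ b
    · simp [mul_add, Finset.sum_add_distrib]
    · simp only [Pi.smul_apply, smul_eq_mul, Finset.mul_sum]
      exact Finset.sum_congr rfl fun v _ => by ring
  refine convexHull_min ?_ hconv hx
  rintro _ ⟨T, hT, rfl⟩
  simpa using hz T hT

theorem le_one_of_mem_STAB {V : Type*} [Fintype V] [DecidableEq V] {G : SimpleGraph V}
    {x : V → ℝ} (hx : x ∈ STAB G) (v : V) : x v ≤ 1 := by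
  have h := sum_mul_le_of_mem_STAB (z := Pi.single v 1) (b := 1) (fun T _ => ?_) hx
  · simpa [Pi.single_apply] using h
  · rw [Finset.sum_pi_single']
    split_ifs <;> norm_num

theorem graphEntropy_nonneg {V : Type*} [Fintype V] [DecidableEq V] (G : SimpleGraph V) :
    0 ≤ graphEntropy G := by
  refine Real.sInf_nonneg ?_
  rintro _ ⟨x, hx, hpos, rfl⟩
  rw [neg_mul, neg_nonneg]
  refine mul_nonpos_of_nonneg_of_nonpos (by positivity) (Finset.sum_nonpos fun v _ => ?_)
  exact Real.logb_nonpos one_lt_two (hpos v).le (le_one_of_mem_STAB hx v)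

theorem exists_pos_mem_STAB {V : Type*} [Fintype V] [DecidableEq V] [Nonempty V]
    (G : SimpleGraph V) : ∃ x ∈ STAB G, ∀ v, 0 < x v := by
  have hn : (0 : ℝ) < Fintype.card V := by exact_mod_cast Fintype.card_pos
  refine ⟨∑ w : V, (1 / (Fintype.card V : ℝ)) • fun v =>
      if v ∈ ({w} : Finset V) then (1 : ℝ) else 0,
    ?_, fun v => ?_⟩
  · refine (convex_convexHull ℝ _).sum_mem (fun _ _ => by positivity) ?_ fun w _ => ?_
    · simp [hn.ne']
    · refine subset_convexHull ℝ _ ⟨{w}, ?_, rfl⟩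
      intro a ha b hb
      rw [Finset.mem_singleton] at ha hb
      simp [ha, hb]
  · simp [Finset.sum_apply, hn]

/-- Every positive point of the antiblocker of `STAB G` gives a lower bound on the entropy. -/
theorem le_graphEntropy_of_antiblocking {V : Type*} [Fintype V] [DecidableEq V] [Nonempty V]
    {G : SimpleGraph V} {z : V → ℝ} (hpos : ∀ v, 0 < z v)
    (hz : ∀ T : Finset V, IsStableSet G T → ∑ v ∈ T, z v ≤ 1) :
    1 / (Fintype.card V : ℝ) * ∑ v, Real.logb 2 (Fintype.card V * z v) ≤ graphEntropy G := by
  have hn : (0 : ℝ) < Fintype.card V := by exact_mod_cast Fintype.card_pos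
  obtain ⟨x₀, hx₀, hx₀pos⟩ := exists_pos_mem_STAB G
  refine le_csInf ⟨_, x₀, hx₀, hx₀pos, rfl⟩ ?_
  rintro _ ⟨x, hx, hxpos, rfl⟩
  have hlog : ∑ v, Real.log (Fintype.card V * z v * x v) ≤ 0 := by
    calc ∑ v, Real.log (Fintype.card V * z v * x v)
        ≤ ∑ v, (Fintype.card V * z v * x v - 1) := Finset.sum_le_sum fun v _ =>
          Real.log_le_sub_one_of_pos (mul_pos (mul_pos hn (hpos v)) (hxpos v))
      _ = Fintype.card V * (∑ v, z v * x v) - Fintype.card V := by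
          simp [Finset.sum_sub_distrib, Finset.mul_sum, mul_assoc]
      _ ≤ 0 := by nlinarith [sum_mul_le_of_mem_STAB hz hx]
  have hlogb : ∑ v, Real.logb 2 (Fintype.card V * z v) + ∑ v, Real.logb 2 (x v) ≤ 0 := by
    rw [← Finset.sum_add_distrib]
    have h : ∀ v, Real.logb 2 (Fintype.card V * z v) + Real.logb 2 (x v)
        = Real.log (Fintype.card V * z v * x v) / Real.log 2 := fun v => by
      rw [← Real.logb_mul (mul_pos hn (hpos v)).ne' (hxpos v).ne', Real.logb]
    simp_rw [h, ← Finset.sum_div]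
    exact div_nonpos_of_nonpos_of_nonneg hlog (Real.log_nonneg one_le_two)
  have := mul_nonpos_of_nonneg_of_nonpos (one_div_nonneg.2 hn.le) hlogb
  linarith

theorem rpow_div_add_rpow_sub_one_le {δ : ℝ} (h0 : 0 < δ) (h1 : δ ≤ 1) (s : ℕ) :
    (s : ℝ) ^ δ / δ + (s + 1 : ℝ) ^ (δ - 1) ≤ (s + 1 : ℝ) ^ δ / δ := by
  have hs : (0 : ℝ) < s + 1 := by positivity
  have hle : 1 / (s + 1 : ℝ) ≤ 1 := by
    rw [div_le_one hs]
    linarith [(Nat.cast_nonneg s : (0 : ℝ) ≤ s)]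
  have hb := rpow_one_add_le_one_add_mul_self (s := -(1 / (s + 1 : ℝ))) (by linarith) h0.le h1
  have hsplit : (s : ℝ) ^ δ = (s + 1 : ℝ) ^ δ * (1 + -(1 / (s + 1 : ℝ))) ^ δ := by
    rw [← Real.mul_rpow hs.le (by linarith)]
    congr 1
    field_simp
    ring
  have hmul : (s : ℝ) ^ δ ≤ (s + 1 : ℝ) ^ δ - δ * (s + 1 : ℝ) ^ (δ - 1) := by
    rw [hsplit, Real.rpow_sub_one hs.ne']
    calc _ ≤ (s + 1 : ℝ) ^ δ * (1 + δ * -(1 / (s + 1 : ℝ))) := by gcongr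
      _ = _ := by field_simp; ring
  rw [← le_sub_iff_add_le, div_le_iff₀ h0, sub_mul, div_mul_cancel₀ _ h0.ne']
  linarith

/-- The dual fitting bound: stable sets have small weight when the vertices of the greedy class
`S i` have weight `|S i| ^ (δ - 1)`. -/
theorem IsGreedySeq.sum_rpow_card_le {V : Type*} [Fintype V] {G : SimpleGraph V}
    {k : ℕ} {S : Fin k → Finset V} (hS : IsGreedySeq G S) {c : V → Fin k}
    (hc : ∀ v i, v ∈ S i ↔ c v = i) {δ : ℝ} (h0 : 0 < δ) (h1 : δ ≤ 1)
    {T : Finset V} (hT : IsStableSet G T) :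
    ∑ v ∈ T, ((S (c v)).card : ℝ) ^ (δ - 1) ≤ (T.card : ℝ) ^ δ / δ := by
  classical
  induction hs : T.card generalizing T with
  | zero => simp [Finset.card_eq_zero.1 hs, h0.ne']
  | succ s ih =>
    obtain ⟨v, hv, hmin⟩ := T.exists_min_image c (Finset.card_pos.1 (by omega))
    have hcard : T.card ≤ (S (c v)).card := by
      refine hS.2.2.2 (c v) T hT fun w hw j hj hwj => ?_
      rw [hc] at hwj
      exact absurd (hmin w hw) (by rw [hwj]; exact not_le.2 hj)
    have hfirst : ((S (c v)).card : ℝ) ^ (δ - 1) ≤ (s + 1 : ℝ) ^ (δ - 1) := by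
      refine Real.rpow_le_rpow_of_nonpos (by positivity) ?_ (by linarith)
      rw [hs] at hcard
      exact_mod_cast hcard
    have hrest := ih (hT.mono (T.erase_subset v)) (by rw [Finset.card_erase_of_mem hv, hs]; rfl)
    rw [← Finset.sum_erase_add _ _ hv]
    push_cast
    linarith [rpow_div_add_rpow_sub_one_le h0 h1 s]

theorem greedyEntropy_eq_sum {V : Type*} [Fintype V] {k : ℕ} {S : Fin k → Finset V}
    {c : V → Fin k} (hc : ∀ v i, v ∈ S i ↔ c v = i) :
    greedyEntropy S = 1 / (Fintype.card V : ℝ) *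
      ∑ v, Real.logb 2 ((Fintype.card V : ℝ) / (S (c v)).card) := by
  classical
  rw [greedyEntropy, ← Finset.sum_fiberwise Finset.univ c, Finset.mul_sum]
  refine Finset.sum_congr rfl fun i _ => ?_
  have hfib : Finset.univ.filter (fun v => c v = i) = S i := by
    ext v
    simp [hc]
  rw [hfib, Finset.sum_congr rfl fun v hv => by rw [(hc v i).1 hv], Finset.sum_const, nsmul_eq_mul]
  ring

theorem IsGreedySeq.greedyEntropy_le {V : Type*} [Fintype V] [DecidableEq V] [Nonempty V]
    {G : SimpleGraph V} {k : ℕ} {S : Fin k → Finset V} (hS : IsGreedySeq G S)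
    {δ : ℝ} (h0 : 0 < δ) (h1 : δ ≤ 1) :
    (1 - δ) * greedyEntropy S ≤ graphEntropy G + Real.logb 2 (1 / δ) := by
  have hn : (0 : ℝ) < Fintype.card V := by exact_mod_cast Fintype.card_pos
  choose c hcmem using hS.2.2.1
  have hc : ∀ v i, v ∈ S i ↔ c v = i := fun v i =>
    ⟨fun hv => by_contra fun hne =>
      Finset.disjoint_left.1 (hS.2.1 _ _ hne) (hcmem v) hv, fun h => h ▸ hcmem v⟩
  have hpos : ∀ v, (0 : ℝ) < (S (c v)).card := fun v => by
    exact_mod_cast Finset.card_pos.2 ⟨v, hcmem v⟩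
  have key := le_graphEntropy_of_antiblocking (G := G)
    (z := fun v => δ / (Fintype.card V : ℝ) ^ δ * ((S (c v)).card : ℝ) ^ (δ - 1))
    (fun v => mul_pos (by positivity) (Real.rpow_pos_of_pos (hpos v) _)) fun T hT => by
      rw [← Finset.mul_sum]
      calc _ ≤ δ / (Fintype.card V : ℝ) ^ δ * ((T.card : ℝ) ^ δ / δ) := by
            gcongr
            exact hS.sum_rpow_card_le hc h0 h1 hT
        _ ≤ δ / (Fintype.card V : ℝ) ^ δ * ((Fintype.card V : ℝ) ^ δ / δ) := by
            gcongr
            exact T.card_le_univ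
        _ = 1 := by
            have : (Fintype.card V : ℝ) ^ δ ≠ 0 := (Real.rpow_pos_of_pos hn δ).ne'
            field_simp
  have hlog : ∀ v, Real.logb 2 (Fintype.card V *
      (δ / (Fintype.card V : ℝ) ^ δ * ((S (c v)).card : ℝ) ^ (δ - 1)))
      = (1 - δ) * Real.logb 2 ((Fintype.card V : ℝ) / (S (c v)).card)
        - Real.logb 2 (1 / δ) := fun v => by
    have hnδ := (Real.rpow_pos_of_pos hn δ).ne'
    have hSδ := (Real.rpow_pos_of_pos (hpos v) (δ - 1)).ne'
    rw [Real.logb_mul hn.ne' (by positivity), Real.logb_mul (by positivity) hSδ,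
      Real.logb_div h0.ne' hnδ, Real.logb_div hn.ne' (hpos v).ne',
      Real.logb_rpow_eq_mul_logb_of_pos hn, Real.logb_rpow_eq_mul_logb_of_pos (hpos v),
      one_div, Real.logb_inv]
    ring
  simp_rw [hlog] at key
  rw [Finset.sum_sub_distrib, ← Finset.mul_sum, Finset.sum_const, Finset.card_univ, nsmul_eq_mul,
    mul_sub, mul_left_comm, ← greedyEntropy_eq_sum hc, ← mul_assoc, one_div_mul_cancel hn.ne',
    one_mul] at key
  linarith

theorem logb_two_one_add_le {x : ℝ} (hx : 1 ≤ x) : Real.logb 2 (1 + x) ≤ x := by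
  rw [Real.logb_le_iff_le_rpow one_lt_two (by linarith)]
  have h := one_add_mul_self_le_rpow_one_add (s := 1) (by norm_num) hx
  norm_num at h
  exact h

theorem greedy_entropy_near_optimal :
    ∃ C : ℝ, ∀ (n : ℕ), 1 ≤ n → ∀ G : SimpleGraph (Fin n), IsPerfect G →
      ∀ (k : ℕ) (S : Fin k → Finset (Fin n)), IsGreedySeq G S →
        greedyEntropy S ≤
          graphEntropy G + Real.logb 2 (graphEntropy G + 1) + C := by
  refine ⟨3, fun n hn G _ k S hS => ?_⟩
  have : Nonempty (Fin n) := ⟨⟨0, hn⟩⟩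
  have hH := graphEntropy_nonneg G
  set H := graphEntropy G
  have hg := hS.greedyEntropy_le (δ := 1 / (H + 2)) (by positivity)
    (by rw [div_le_one (by positivity)]; linarith)
  rw [one_div_one_div] at hg
  have hlinear : Real.logb 2 (H + 2) ≤ H + 1 := by
    have := logb_two_one_add_le (x := H + 1) (by linarith)
    rwa [show 1 + (H + 1) = H + 2 by ring] at this
  have hshift : Real.logb 2 (H + 2) ≤ Real.logb 2 (H + 1) + 1 := by
    calc Real.logb 2 (H + 2) ≤ Real.logb 2 ((H + 1) * 2) :=
          Real.logb_le_logb_of_le one_lt_two (by positivity) (by linarith)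
      _ = Real.logb 2 (H + 1) + 1 := by
          rw [Real.logb_mul (by positivity) two_ne_zero, Real.logb_self_eq_one one_lt_two]
  have hscaled : (H + 1) * greedyEntropy S ≤ (H + 2) * (H + Real.logb 2 (H + 2)) := by
    calc (H + 1) * greedyEntropy S
        = (H + 2) * ((1 - 1 / (H + 2)) * greedyEntropy S) := by field_simp; ring
      _ ≤ _ := by gcongr
  refine le_of_mul_le_mul_left (hscaled.trans ?_) (by positivity : 0 < H + 1)
  nlinarith
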